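/- Let d ≥ 1, and adopt the stochastic Fourier advection–diffusion setup with diffusivity ν ∈ (0, e^{−1}], initial data g, mixing constants K ≥ 1, γ > 0, and asymptotic mass measure m. Suppose in addition there are deterministic constants L ≥ 1 and D ≥ 1 such that almost surely, for all t ≥ 0 and all k ∈ ℤ^d, |v_t(k)| ≤ D · 1_{|k| ≤ L}. Then there is a constant C ≥ 2, depending only on d, K, γ, L, and N₀, such that for every r with C ≤ r ≤ ν^{−1/2} / (C (log ν^{−1})^{1/2}): m([r − L, r + L]) ≥ 1 / (C D r). -/

import Mathlib

open MeasureTheory ENNReal Real Set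
open scoped Classical

noncomputable section

/-- Euclidean norm of a lattice point `k ∈ ℤ^d`. -/
def znorm {d : ℕ} (k : Fin d → ℤ) : ℝ := Real.sqrt (∑ i, ((k i : ℝ)) ^ 2)

/-- Euclidean norm of a vector in `ℂ^d`. -/
def cnorm {d : ℕ} (z : Fin d → ℂ) : ℝ := Real.sqrt (∑ i, ‖z i‖ ^ 2)

/-- Pairing `k · z = Σ_i k_i z_i`. -/
def zdot {d : ℕ} (k : Fin d → ℤ) (z : Fin d → ℂ) : ℂ := ∑ i, (k i : ℂ) * z i

/-- Divergence-free in Fourier variables: `k · v(k) = 0` for all `k`. -/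
def DivFree {d : ℕ} (v : (Fin d → ℤ) → Fin d → ℂ) : Prop := ∀ k, zdot k (v k) = 0

/-- Fourier coefficients of a real vector field: `v(-k) = conj (v k)`. -/
def RealCoeff {d : ℕ} (v : (Fin d → ℤ) → Fin d → ℂ) : Prop :=
  ∀ k i, v (-k) i = starRingEnd ℂ (v k i)

/-- A weight: nondecreasing on `[0,∞)` with values in `[1,∞]`. -/
def IsWeight (w : ℝ → ℝ≥0∞) : Prop :=
  MonotoneOn w (Set.Ici 0) ∧ ∀ s, 0 ≤ s → 1 ≤ w s

/-- Weighted ℓ¹ norm `‖w v‖_{ℓ¹} = Σ_k w(|k|)|v(k)|`. -/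
def wl1 {d : ℕ} (w : ℝ → ℝ≥0∞) (v : (Fin d → ℤ) → Fin d → ℂ) : ℝ≥0∞ :=
  ∑' k, w (znorm k) * ENNReal.ofReal (cnorm (v k))

/-- `(w⁻¹ * m_a)(r) = Σ_k w(||k|-r|)⁻¹ |a(k)|²`. -/
def convMass {d : ℕ} (w : ℝ → ℝ≥0∞) (a : (Fin d → ℤ) → ℂ) (r : ℝ) : ℝ≥0∞ :=
  ∑' k, (w |znorm k - r|)⁻¹ * (‖a k‖₊ : ℝ≥0∞) ^ 2

/-- `m_a(E) = Σ_{|k| ∈ E} |a(k)|²`. -/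
def massOn {d : ℕ} (a : (Fin d → ℤ) → ℂ) (E : Set ℝ) : ℝ≥0∞ :=
  ∑' k, if znorm k ∈ E then (‖a k‖₊ : ℝ≥0∞) ^ 2 else 0

/-- Logarithmic density measure `μ_{a,b}(E)`. -/
def logDensity (a b : ℝ) (E : Set ℝ) : ℝ≥0∞ :=
  (ENNReal.ofReal (Real.log (b / a)))⁻¹ * ∫⁻ r in E ∩ Set.Icc a b, ENNReal.ofReal r⁻¹

/-- The right-hand side of the Fourier advection–diffusion system. -/
def fourierRHS {d : ℕ} (ν : ℝ) (v : (Fin d → ℤ) → Fin d → ℂ) (a : (Fin d → ℤ) → ℂ)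
    (k : Fin d → ℤ) : ℂ :=
  Complex.ofReal (-(4 * π ^ 2 * ν * znorm k ^ 2)) * a k
    - 2 * Complex.ofReal π * Complex.I * ∑' j, zdot k (v (k - j)) * a j


/-- The asymptotic mass measure `m(E) = 𝔼 ∫_0^∞ m_{a_t}(E) dt`. -/
def asymMass {d : ℕ} {Ω : Type*} [MeasurableSpace Ω] (ℙ : Measure Ω)
    (a : Ω → ℝ → (Fin d → ℤ) → ℂ) (E : Set ℝ) : ℝ≥0∞ :=
  ∫⁻ ω, (∫⁻ t in Set.Ici (0 : ℝ), massOn (a ω t) E) ∂ℙ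

/-- The stochastic Fourier advection–diffusion setup: measurability, a divergence-free
real velocity, initial data `g` of unit mass and zero mean, the Fourier-coefficient
advection–diffusion ODE, rapid decrease locally uniformly in time, and the
uniform-in-diffusivity exponential mixing bound. -/
def AdvectionSetup {d : ℕ} {Ω : Type*} [MeasurableSpace Ω] (ℙ : Measure Ω) (ν K γ : ℝ)
    (v : Ω → ℝ → (Fin d → ℤ) → Fin d → ℂ) (a : Ω → ℝ → (Fin d → ℤ) → ℂ)
    (g : (Fin d → ℤ) → ℂ) : Prop :=
  (∀ k : Fin d → ℤ, Measurable fun p : Ω × ℝ => a p.1 p.2 k) ∧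
  (∀ (k : Fin d → ℤ) (i : Fin d), Measurable fun p : Ω × ℝ => v p.1 p.2 k i) ∧
  g 0 = 0 ∧
  (∑' k : Fin d → ℤ, (‖g k‖₊ : ℝ≥0∞) ^ 2) = 1 ∧
  (∀ᵐ ω ∂ℙ,
    (∀ t : ℝ, 0 ≤ t → DivFree (v ω t) ∧ RealCoeff (v ω t)) ∧
    a ω 0 = g ∧
    (∀ (k : Fin d → ℤ), ∀ t ∈ Set.Ici (0 : ℝ),
      HasDerivWithinAt (fun s => a ω s k) (fourierRHS ν (v ω t) (a ω t) k) (Set.Ici 0) t) ∧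
    (∀ N : ℕ, ∀ T > (0 : ℝ), ∃ M : ℝ, ∀ t ∈ Set.Icc (0 : ℝ) T,
      ∑' k : Fin d → ℤ, ENNReal.ofReal ((1 + znorm k) ^ N) * (‖a ω t k‖₊ : ℝ≥0∞) ^ 2
        ≤ ENNReal.ofReal M)) ∧
  (∀ t : ℝ, 0 ≤ t →
    (∫⁻ ω, (∑' k : Fin d → ℤ, if k = 0 then 0 else
        (ENNReal.ofReal ((2 * π * znorm k) ^ 2))⁻¹ * (‖a ω t k‖₊ : ℝ≥0∞) ^ 2) ∂ℙ)
      ≤ ENNReal.ofReal (K * Real.exp (-γ * t)))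

lemma znorm_eq_norm {d : ℕ} (k : Fin d → ℤ) :
    znorm k = ‖WithLp.toLp 2 (fun i => (k i : ℝ))‖ := by
  simp [znorm, EuclideanSpace.norm_eq]

lemma znorm_nonneg {d : ℕ} (k : Fin d → ℤ) : 0 ≤ znorm k := Real.sqrt_nonneg _

lemma znorm_le_add_sub {d : ℕ} (j k : Fin d → ℤ) : znorm j ≤ znorm k + znorm (k - j) := by
  rw [znorm_eq_norm, znorm_eq_norm, znorm_eq_norm, ← norm_neg (WithLp.toLp 2 fun i => ((k - j) i : ℝ))]
  refine le_trans (le_of_eq ?_) (norm_add_le _ _)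
  congr 1
  ext i
  simp

lemma znorm_pos {d : ℕ} {k : Fin d → ℤ} (hk : k ≠ 0) : 0 < znorm k := by
  rw [znorm_eq_norm, norm_pos_iff]
  intro h
  apply hk
  ext i
  have := congrArg (fun z : EuclideanSpace ℝ (Fin d) => z i) h
  simpa using this

lemma finite_znorm_le (d : ℕ) (R : ℝ) : {k : Fin d → ℤ | znorm k ≤ R}.Finite := by
  refine (Set.Finite.pi' (fun _ : Fin d => Set.finite_Icc (-⌈R⌉) ⌈R⌉)).subset ?_
  intro k hk i
  have h1 : |(k i : ℝ)| ≤ znorm k :=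
    Real.abs_le_sqrt (Finset.single_le_sum (f := fun i => (k i : ℝ) ^ 2)
      (fun i _ => sq_nonneg _) (Finset.mem_univ i))
  have h2 : |(k i : ℝ)| ≤ (⌈R⌉ : ℝ) := h1.trans (le_trans hk (Int.le_ceil R))
  rw [abs_le] at h2
  exact ⟨by exact_mod_cast h2.1, by exact_mod_cast h2.2⟩

lemma norm_zdot_le {d : ℕ} (k : Fin d → ℤ) (z : Fin d → ℂ) :
    ‖zdot k z‖ ≤ znorm k * cnorm z := by
  calc ‖zdot k z‖ ≤ ∑ i, |(k i : ℝ)| * ‖z i‖ := by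
        refine (norm_sum_le _ _).trans (le_of_eq (Finset.sum_congr rfl fun i _ => ?_))
        rw [norm_mul, Complex.norm_intCast]
    _ ≤ Real.sqrt (∑ i, |(k i : ℝ)| ^ 2) * Real.sqrt (∑ i, ‖z i‖ ^ 2) :=
        Real.sum_mul_le_sqrt_mul_sqrt _ _ _
    _ = znorm k * cnorm z := by simp [znorm, cnorm, sq_abs]

lemma eq_zero_of_cnorm_le_zero {d : ℕ} {z : Fin d → ℂ} (h : cnorm z ≤ 0) : z = 0 := by
  have h0 : ∑ i, ‖z i‖ ^ 2 ≤ 0 := by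
    simpa using Real.sqrt_eq_zero'.1 (le_antisymm h (Real.sqrt_nonneg _))
  ext i
  have := (Finset.sum_eq_zero_iff_of_nonneg (fun i _ => sq_nonneg ‖z i‖)).1
    (le_antisymm h0 (Finset.sum_nonneg fun i _ => sq_nonneg _)) i (Finset.mem_univ i)
  simpa using this

/-- The advection matrix `(k, j) ↦ k · v(k - j)` is Hermitian. -/
lemma conj_zdot_sub {d : ℕ} {v : (Fin d → ℤ) → Fin d → ℂ} (hdiv : DivFree v)
    (hreal : RealCoeff v) (k j : Fin d → ℤ) :
    starRingEnd ℂ (zdot k (v (k - j))) = zdot j (v (j - k)) := by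
  have h1 : starRingEnd ℂ (zdot k (v (k - j))) = zdot k (v (j - k)) := by
    simp only [zdot, map_sum, map_mul, map_intCast]
    refine Finset.sum_congr rfl fun i _ => ?_
    rw [← hreal, neg_sub]
  have h2 : zdot j (v (j - k)) - zdot k (v (j - k)) = zdot (j - k) (v (j - k)) := by
    simp only [zdot, ← Finset.sum_sub_distrib]
    refine Finset.sum_congr rfl fun i _ => ?_
    simp
    ring
  rw [h1, ← sub_eq_zero, ← neg_sub, h2, hdiv, neg_zero]

lemma im_sum_conj_mul_zdot_eq_zero {d : ℕ} {v : (Fin d → ℤ) → Fin d → ℂ} (hdiv : DivFree v)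
    (hreal : RealCoeff v) (a : (Fin d → ℤ) → ℂ) (S : Finset (Fin d → ℤ)) :
    (∑ k ∈ S, ∑ j ∈ S, starRingEnd ℂ (a k) * (zdot k (v (k - j)) * a j)).im = 0 := by
  rw [← Complex.conj_eq_iff_im]
  simp only [map_sum, map_mul, conj_zdot_sub hdiv hreal, Complex.conj_conj]
  rw [Finset.sum_comm]
  refine Finset.sum_congr rfl fun k _ => Finset.sum_congr rfl fun j _ => by ring

/-- The interaction between the modes inside and outside a ball of radius `r` is controlled by
the mass in the annulus of half-width `L` around radius `r`. -/
lemma norm_flux_le {d : ℕ} {L D r : ℝ} (hD : 0 ≤ D) (hr : 0 ≤ r)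
    {v : (Fin d → ℤ) → Fin d → ℂ} (hv : ∀ k, cnorm (v k) ≤ if znorm k ≤ L then D else 0)
    (a : (Fin d → ℤ) → ℂ) {S P B : Finset (Fin d → ℤ)} (hS : ∀ k, k ∈ S ↔ znorm k < r)
    (hP : ∀ k, k ∈ P ↔ znorm k ∈ Set.Icc (r - L) (r + L)) (hB : ∀ k, k ∈ B ↔ znorm k ≤ L) :
    ‖∑ k ∈ S, ∑ j ∈ P \ S, starRingEnd ℂ (a k) * (zdot k (v (k - j)) * a j)‖
      ≤ r * D * B.card * ∑ k ∈ P, ‖a k‖ ^ 2 := by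
  set F : (Fin d → ℤ) → (Fin d → ℤ) → ℝ := fun k j =>
    if k - j ∈ B then r * D * ((‖a k‖ ^ 2 + ‖a j‖ ^ 2) / 2) else 0 with hF
  have hF0 : ∀ k j, 0 ≤ F k j := by
    intro k j
    simp only [hF]
    split_ifs <;> positivity
  have hcard1 : ∀ k, ((P.filter fun j => k - j ∈ B).card : ℝ) ≤ B.card := by
    intro k
    exact_mod_cast Finset.card_le_card_of_injOn (fun j => k - j)
      (fun j hj => (Finset.mem_filter.1 hj).2) (fun x _ y _ h => sub_right_injective h)
  have hcard2 : ∀ j, ((P.filter fun k => k - j ∈ B).card : ℝ) ≤ B.card := by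
    intro j
    exact_mod_cast Finset.card_le_card_of_injOn (fun k => k - j)
      (fun k hk => (Finset.mem_filter.1 hk).2) (fun x _ y _ h => sub_left_injective h)
  have hterm : ∀ k ∈ S, ∀ j ∈ P \ S,
      ‖starRingEnd ℂ (a k) * (zdot k (v (k - j)) * a j)‖ ≤ if k ∈ P then F k j else 0 := by
    intro k hk j hj
    rw [Finset.mem_sdiff, hS, not_lt] at hj
    rw [hS] at hk
    by_cases hkj : znorm (k - j) ≤ L
    · have h1 := znorm_le_add_sub j k
      have hkP : k ∈ P := (hP k).2 ⟨by linarith [hj.2], by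
        linarith [(znorm_nonneg (k - j)).trans hkj]⟩
      have hvD : cnorm (v (k - j)) ≤ D := by simpa [hkj] using hv (k - j)
      have hz : ‖zdot k (v (k - j))‖ ≤ r * D :=
        (norm_zdot_le _ _).trans (mul_le_mul hk.le hvD (Real.sqrt_nonneg _) hr)
      have hab : ‖a k‖ * ‖a j‖ ≤ (‖a k‖ ^ 2 + ‖a j‖ ^ 2) / 2 := by
        nlinarith [sq_nonneg (‖a k‖ - ‖a j‖)]
      simp only [hF, hkP, (hB _).2 hkj, if_true, norm_mul, RCLike.norm_conj]
      calc ‖a k‖ * (‖zdot k (v (k - j))‖ * ‖a j‖)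
          = ‖zdot k (v (k - j))‖ * (‖a k‖ * ‖a j‖) := by ring
        _ ≤ _ := mul_le_mul hz hab (by positivity) (by positivity)
    · have hv0 : v (k - j) = 0 := eq_zero_of_cnorm_le_zero (by simpa [hkj] using hv (k - j))
      have : zdot k (v (k - j)) = 0 := by simp [zdot, hv0]
      rw [this]
      simp only [zero_mul, mul_zero, norm_zero]
      split_ifs
      · exact hF0 k j
      · rfl
  calc ‖∑ k ∈ S, ∑ j ∈ P \ S, starRingEnd ℂ (a k) * (zdot k (v (k - j)) * a j)‖
      ≤ ∑ k ∈ S, ∑ j ∈ P \ S, (if k ∈ P then F k j else 0) :=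
        (norm_sum_le _ _).trans (Finset.sum_le_sum fun k hk =>
          (norm_sum_le _ _).trans (Finset.sum_le_sum fun j hj => hterm k hk j hj))
    _ ≤ ∑ k ∈ S, (if k ∈ P then ∑ j ∈ P, F k j else 0) := by
        refine Finset.sum_le_sum fun k _ => ?_
        split_ifs
        · exact Finset.sum_le_sum_of_subset_of_nonneg Finset.sdiff_subset fun j _ _ => hF0 k j
        · simp
    _ ≤ ∑ k ∈ P, ∑ j ∈ P, F k j := by
        rw [← Finset.sum_filter]
        exact Finset.sum_le_sum_of_subset_of_nonneg
          (fun k hk => (Finset.mem_filter.1 hk).2)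
          fun k _ _ => Finset.sum_nonneg fun j _ => hF0 k j
    _ = (r * D / 2) * (∑ k ∈ P, (P.filter fun j => k - j ∈ B).card * ‖a k‖ ^ 2
          + ∑ j ∈ P, (P.filter fun k => k - j ∈ B).card * ‖a j‖ ^ 2) := by
        have e1 : ∀ k, ((P.filter fun j => k - j ∈ B).card : ℝ) * ‖a k‖ ^ 2
            = ∑ j ∈ P, if k - j ∈ B then ‖a k‖ ^ 2 else 0 := by
          intro k
          rw [← Finset.sum_filter, Finset.sum_const, nsmul_eq_mul]
        have e2 : ∀ j, ((P.filter fun k => k - j ∈ B).card : ℝ) * ‖a j‖ ^ 2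
            = ∑ k ∈ P, if k - j ∈ B then ‖a j‖ ^ 2 else 0 := by
          intro k
          rw [← Finset.sum_filter, Finset.sum_const, nsmul_eq_mul]
        simp only [e1, e2]
        rw [Finset.sum_comm (f := fun j k => if k - j ∈ B then ‖a j‖ ^ 2 else 0),
          ← Finset.sum_add_distrib, Finset.mul_sum]
        refine Finset.sum_congr rfl fun k _ => ?_
        rw [← Finset.sum_add_distrib, Finset.mul_sum]
        refine Finset.sum_congr rfl fun j _ => ?_
        simp only [hF]
        split_ifs <;> ring
    _ ≤ (r * D / 2) * (∑ k ∈ P, B.card * ‖a k‖ ^ 2 + ∑ j ∈ P, B.card * ‖a j‖ ^ 2) := by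
        refine mul_le_mul_of_nonneg_left (add_le_add ?_ ?_) (by positivity) <;>
          refine Finset.sum_le_sum fun k _ => mul_le_mul_of_nonneg_right ?_ (sq_nonneg _)
        · exact hcard1 k
        · exact hcard2 k
    _ = r * D * B.card * ∑ k ∈ P, ‖a k‖ ^ 2 := by
        rw [← Finset.mul_sum]
        ring

/-- Balance of the mass in a ball: up to dissipation, its rate of change is the flux. -/
lemma abs_sum_re_conj_mul_fourierRHS_add_le {d : ℕ} {ν L D r : ℝ} (hD : 0 ≤ D)
    (hr : 0 ≤ r) {v : (Fin d → ℤ) → Fin d → ℂ} (hdiv : DivFree v) (hreal : RealCoeff v)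
    (hv : ∀ k, cnorm (v k) ≤ if znorm k ≤ L then D else 0)
    (a : (Fin d → ℤ) → ℂ) {S P B : Finset (Fin d → ℤ)} (hS : ∀ k, k ∈ S ↔ znorm k < r)
    (hP : ∀ k, k ∈ P ↔ znorm k ∈ Set.Icc (r - L) (r + L)) (hB : ∀ k, k ∈ B ↔ znorm k ≤ L) :
    |∑ k ∈ S, 2 * (starRingEnd ℂ (a k) * fourierRHS ν v a k).re
        + 8 * π ^ 2 * ν * ∑ k ∈ S, znorm k ^ 2 * ‖a k‖ ^ 2|
      ≤ 4 * π * B.card * r * D * ∑ k ∈ P, ‖a k‖ ^ 2 := by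
  have htsum : ∀ k ∈ S, ∑' j, zdot k (v (k - j)) * a j
      = ∑ j ∈ S, zdot k (v (k - j)) * a j + ∑ j ∈ P \ S, zdot k (v (k - j)) * a j := by
    intro k hk
    rw [hS] at hk
    rw [← Finset.sum_union Finset.disjoint_sdiff, Finset.union_sdiff_self_eq_union]
    refine tsum_eq_sum fun j hj => ?_
    rw [Finset.mem_union, not_or, hS, hP, not_lt] at hj
    have hkj : ¬ znorm (k - j) ≤ L := by
      intro hkj
      exact hj.2 ⟨by linarith [hj.1, (znorm_nonneg (k - j)).trans hkj],
        by linarith [znorm_le_add_sub j k]⟩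
    have hv0 : v (k - j) = 0 := eq_zero_of_cnorm_le_zero (by simpa [hkj] using hv (k - j))
    simp [zdot, hv0]
  set X := ∑ k ∈ S, ∑ j ∈ S, starRingEnd ℂ (a k) * (zdot k (v (k - j)) * a j) with hX
  set Y := ∑ k ∈ S, ∑ j ∈ P \ S, starRingEnd ℂ (a k) * (zdot k (v (k - j)) * a j) with hY
  have hX0 : X.im = 0 := im_sum_conj_mul_zdot_eq_zero hdiv hreal a S
  have hYle : ‖Y‖ ≤ r * D * B.card * ∑ k ∈ P, ‖a k‖ ^ 2 := norm_flux_le hD hr hv a hS hP hB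
  have key : ∑ k ∈ S, 2 * (starRingEnd ℂ (a k) * fourierRHS ν v a k).re
      + 8 * π ^ 2 * ν * ∑ k ∈ S, znorm k ^ 2 * ‖a k‖ ^ 2 = 4 * π * (X + Y).im := by
    rw [hX, hY, ← Finset.sum_add_distrib, Complex.im_sum, Finset.mul_sum, Finset.mul_sum,
      ← Finset.sum_add_distrib]
    refine Finset.sum_congr rfl fun k hk => ?_
    rw [← Finset.mul_sum, ← Finset.mul_sum, ← mul_add, ← htsum k hk, fourierRHS]
    generalize ∑' j, zdot k (v (k - j)) * a j = Z
    rw [← Complex.normSq_eq_norm_sq, Complex.normSq_apply]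
    simp [pow_two]
    ring
  rw [key, Complex.add_im, hX0, zero_add, abs_mul, abs_of_pos (by positivity)]
  calc 4 * π * |Y.im| ≤ 4 * π * (r * D * B.card * ∑ k ∈ P, ‖a k‖ ^ 2) := by
        gcongr
        exact (Complex.abs_im_le_norm Y).trans hYle
    _ = _ := by ring

/-- A function that decreases at most at rate `κ M + h` and increases at most at rate `h`. -/
lemma le_of_deriv_bounds {M M' h : ℝ → ℝ} {κ T : ℝ} (hκ : 0 ≤ κ) (hT : 0 ≤ T)
    (hh : Continuous h) (hh0 : ∀ t, 0 ≤ h t) (hM : ContinuousOn M (Set.Icc 0 T))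
    (hM' : ∀ t ∈ Set.Ioo 0 T, HasDerivAt M (M' t) t)
    (hub : ∀ t ∈ Set.Ioo 0 T, M' t ≤ h t)
    (hlb : ∀ t ∈ Set.Ioo 0 T, -(κ * M t) - h t ≤ M' t) :
    M 0 ≤ M T + (∫ t in (0 : ℝ)..T, h t) + κ * T * (M 0 + ∫ t in (0 : ℝ)..T, h t) := by
  have hH : ∀ t, HasDerivAt (fun t => ∫ s in (0 : ℝ)..t, h s) (h t) t := fun t =>
    intervalIntegral.integral_hasDerivAt_right (hh.intervalIntegrable _ _)
      (hh.stronglyMeasurableAtFilter _ _) hh.continuousAt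
  have hHmono : Monotone fun t => ∫ s in (0 : ℝ)..t, h s :=
    monotone_of_deriv_nonneg (fun t => (hH t).differentiableAt)
      fun t => by rw [(hH t).deriv]; exact hh0 t
  have hHc : Continuous fun t => ∫ s in (0 : ℝ)..t, h s :=
    continuous_iff_continuousAt.2 fun t => (hH t).continuousAt
  have hanti : AntitoneOn (fun t => M t - ∫ s in (0 : ℝ)..t, h s) (Set.Icc 0 T) := by
    refine antitoneOn_of_deriv_nonpos (convex_Icc 0 T) (hM.sub hHc.continuousOn) ?_ ?_ <;>
      rw [interior_Icc]
    · exact fun t ht => ((hM' t ht).sub (hH t)).differentiableAt.differentiableWithinAt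
    · intro t ht
      rw [((hM' t ht).fun_sub (hH t)).deriv]
      linarith [hub t ht]
  have hMle : ∀ t ∈ Set.Icc 0 T, M t ≤ M 0 + ∫ s in (0 : ℝ)..T, h s := by
    intro t ht
    have h1 := hanti ⟨le_rfl, hT⟩ ht ht.1
    have h2 := hHmono ht.2
    simp only [intervalIntegral.integral_same] at h1 h2
    linarith
  set A := M 0 + ∫ s in (0 : ℝ)..T, h s with hA
  have hlin : ∀ t, HasDerivAt (fun t : ℝ => κ * A * t) (κ * A) t := fun t => by
    simpa using (hasDerivAt_id t).const_mul (κ * A)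
  have hmono : MonotoneOn (fun t => M t + (∫ s in (0 : ℝ)..t, h s) + κ * A * t)
      (Set.Icc 0 T) := by
    refine monotoneOn_of_deriv_nonneg (convex_Icc 0 T)
      ((hM.add hHc.continuousOn).add (by fun_prop)) ?_ ?_ <;> rw [interior_Icc]
    · exact fun t ht =>
        (((hM' t ht).add (hH t)).add (hlin t)).differentiableAt.differentiableWithinAt
    · intro t ht
      rw [(((hM' t ht).fun_add (hH t)).fun_add (hlin t)).deriv]
      have := mul_le_mul_of_nonneg_left (hMle t (Set.Ioo_subset_Icc_self ht)) hκ
      linarith [hlb t ht]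
  have := hmono (Set.left_mem_Icc.2 hT) (Set.right_mem_Icc.2 hT) hT
  simp only [intervalIntegral.integral_same] at this
  linarith

lemma massOn_eq_ofReal_sum {d : ℕ} (a : (Fin d → ℤ) → ℂ) {E : Set ℝ}
    {P : Finset (Fin d → ℤ)} (hP : ∀ k, k ∈ P ↔ znorm k ∈ E) :
    massOn a E = ENNReal.ofReal (∑ k ∈ P, ‖a k‖ ^ 2) := by
  rw [massOn, tsum_eq_sum (s := P) fun k hk => if_neg fun h => hk ((hP k).2 h),
    ENNReal.ofReal_sum_of_nonneg fun k _ => sq_nonneg _]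
  refine Finset.sum_congr rfl fun k hk => ?_
  rw [if_pos ((hP k).1 hk), ENNReal.ofReal_pow (norm_nonneg _), ofReal_norm, enorm_eq_nnnorm]

lemma massOn_Iio_add_massOn_Ici {d : ℕ} (a : (Fin d → ℤ) → ℂ) (r : ℝ) :
    massOn a (Set.Iio r) + massOn a (Set.Ici r) = ∑' k, (‖a k‖₊ : ℝ≥0∞) ^ 2 := by
  rw [massOn, massOn, ← ENNReal.tsum_add]
  refine tsum_congr fun k => ?_
  by_cases h : znorm k < r
  · simp [h, not_le.2 h]
  · simp [h, not_lt.1 h]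

lemma massOn_mono {d : ℕ} (a : (Fin d → ℤ) → ℂ) {E E' : Set ℝ} (h : E ⊆ E') :
    massOn a E ≤ massOn a E' := by
  refine ENNReal.tsum_le_tsum fun k => ?_
  by_cases hk : znorm k ∈ E
  · simp [hk, h hk]
  · simp [hk]

/-- Pathwise lower bound: the mass initially in a ball either stays there, is dissipated, or
crosses the annulus around the boundary of the ball. -/
lemma massOn_initial_le {d : ℕ} {ν L D r T δ : ℝ} (hν : 0 ≤ ν) (hD : 0 ≤ D) (hr : 0 ≤ r)
    (hT : 0 ≤ T) {v : ℝ → (Fin d → ℤ) → Fin d → ℂ} {a : ℝ → (Fin d → ℤ) → ℂ}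
    (hv : ∀ t, 0 ≤ t → DivFree (v t) ∧ RealCoeff (v t))
    (ha : ∀ k, ∀ t ∈ Set.Ici (0 : ℝ),
      HasDerivWithinAt (fun s => a s k) (fourierRHS ν (v t) (a t) k) (Set.Ici 0) t)
    (hvb : ∀ t, 0 ≤ t → ∀ k, cnorm (v t k) ≤ if znorm k ≤ L then D else 0)
    (hδ : 8 * π ^ 2 * ν * r ^ 2 * T ≤ δ)
    {S P B : Finset (Fin d → ℤ)} (hS : ∀ k, k ∈ S ↔ znorm k < r)
    (hP : ∀ k, k ∈ P ↔ znorm k ∈ Set.Icc (r - L) (r + L)) (hB : ∀ k, k ∈ B ↔ znorm k ≤ L) :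
    massOn (a 0) (Set.Iio r) ≤ massOn (a T) (Set.Iio r)
      + ENNReal.ofReal δ * massOn (a 0) (Set.Iio r)
      + ENNReal.ofReal ((1 + δ) * (4 * π * B.card * r * D)) *
        ∫⁻ t in Set.Ici (0 : ℝ), massOn (a t) (Set.Icc (r - L) (r + L)) := by
  set c := 4 * π * B.card * r * D with hc
  have hc0 : 0 ≤ c := by positivity
  have hδ0 : 0 ≤ δ := le_trans (by positivity) hδ
  set M : ℝ → ℝ := fun t => ∑ k ∈ S, ‖a t k‖ ^ 2 with hM
  set p : ℝ → ℝ := fun t => ∑ k ∈ P, ‖a (max t 0) k‖ ^ 2 with hp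
  have hac : ∀ k, ContinuousOn (fun t => a t k) (Set.Ici 0) := fun k t ht =>
    (ha k t ht).continuousWithinAt
  have hpc : Continuous p := by
    refine continuous_finsetSum _ fun k _ => (Continuous.norm ?_).pow 2
    exact (hac k).comp_continuous (by fun_prop) fun t => le_max_right t 0
  have hp0 : ∀ t, 0 ≤ p t := fun t => Finset.sum_nonneg fun k _ => sq_nonneg _
  have hMc : ContinuousOn M (Set.Ici 0) :=
    continuousOn_finsetSum _ fun k _ => (hac k).norm.pow 2
  have hM0 : 0 ≤ M 0 := Finset.sum_nonneg fun k _ => sq_nonneg _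
  have hMT : 0 ≤ M T := Finset.sum_nonneg fun k _ => sq_nonneg _
  have hbal : ∀ t ∈ Set.Ioo 0 T, |∑ k ∈ S, 2 * (starRingEnd ℂ (a t k) *
      fourierRHS ν (v t) (a t) k).re + 8 * π ^ 2 * ν * ∑ k ∈ S, znorm k ^ 2 * ‖a t k‖ ^ 2|
      ≤ c * p t := by
    intro t ht
    have := abs_sum_re_conj_mul_fourierRHS_add_le (ν := ν) hD hr (hv t ht.1.le).1
      (hv t ht.1.le).2 (hvb t ht.1.le) (a t) hS hP hB
    simpa only [hp, max_eq_left ht.1.le] using this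
  have hdiss : ∀ t, ∑ k ∈ S, znorm k ^ 2 * ‖a t k‖ ^ 2 ≤ r ^ 2 * M t := by
    intro t
    rw [hM, Finset.mul_sum]
    refine Finset.sum_le_sum fun k hk => ?_
    have := ((hS k).1 hk).le
    have := znorm_nonneg k
    gcongr
  have hmain := le_of_deriv_bounds (M := M) (h := fun t => c * p t)
    (M' := fun t => ∑ k ∈ S, 2 * (starRingEnd ℂ (a t k) * fourierRHS ν (v t) (a t) k).re)
    (κ := 8 * π ^ 2 * ν * r ^ 2) (by positivity) hT (by fun_prop)
    (fun t => mul_nonneg hc0 (hp0 t)) (hMc.mono Set.Icc_subset_Ici_self)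
    (by
      intro t ht
      refine HasDerivAt.fun_sum fun k _ => ?_
      have h1 := ((ha k t ht.1.le).hasDerivAt (Ici_mem_nhds ht.1)).norm_sq
      rwa [Complex.inner, mul_comm (fourierRHS _ _ _ _)] at h1)
    (by
      intro t ht
      have h1 := (abs_le.1 (hbal t ht)).2
      have : 0 ≤ 8 * π ^ 2 * ν * ∑ k ∈ S, znorm k ^ 2 * ‖a t k‖ ^ 2 := by positivity
      linarith)
    (by
      intro t ht
      have h1 := (abs_le.1 (hbal t ht)).1
      have h2 := mul_le_mul_of_nonneg_left (hdiss t) (show 0 ≤ 8 * π ^ 2 * ν by positivity)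
      linarith)
  set J := ∫ t in (0 : ℝ)..T, p t with hJ
  have hJ0 : 0 ≤ J := intervalIntegral.integral_nonneg hT fun t _ => hp0 t
  rw [intervalIntegral.integral_const_mul, ← hJ] at hmain
  have hreal : M 0 ≤ M T + δ * M 0 + (1 + δ) * c * J := by
    have := mul_le_mul_of_nonneg_right hδ (show 0 ≤ M 0 + c * J by positivity)
    linarith
  have hJle : ENNReal.ofReal J
      ≤ ∫⁻ t in Set.Ici (0 : ℝ), massOn (a t) (Set.Icc (r - L) (r + L)) := by
    rw [hJ, intervalIntegral.integral_of_le hT,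
      ofReal_integral_eq_lintegral_ofReal (hpc.intervalIntegrable 0 T).1
        (Filter.Eventually.of_forall hp0)]
    calc ∫⁻ t in Set.Ioc 0 T, ENNReal.ofReal (p t)
        = ∫⁻ t in Set.Ioc 0 T, massOn (a t) (Set.Icc (r - L) (r + L)) := by
          refine setLIntegral_congr_fun measurableSet_Ioc fun t ht => ?_
          simp only [massOn_eq_ofReal_sum (a t) hP, hp, max_eq_left ht.1.le]
      _ ≤ _ := lintegral_mono_set fun t ht => ht.1.le
  have hS' : ∀ k, k ∈ S ↔ znorm k ∈ Set.Iio r := hS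
  rw [massOn_eq_ofReal_sum (a 0) hS', massOn_eq_ofReal_sum (a T) hS']
  calc ENNReal.ofReal (M 0) ≤ ENNReal.ofReal (M T + δ * M 0 + (1 + δ) * c * J) :=
        ENNReal.ofReal_le_ofReal hreal
    _ = ENNReal.ofReal (M T) + ENNReal.ofReal δ * ENNReal.ofReal (M 0)
        + ENNReal.ofReal ((1 + δ) * c) * ENNReal.ofReal J := by
        rw [ENNReal.ofReal_add (by positivity) (by positivity),
          ENNReal.ofReal_add (by positivity) (by positivity), ENNReal.ofReal_mul hδ0,
          ENNReal.ofReal_mul (by positivity)]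
    _ ≤ _ := by gcongr

lemma coeff_zero_eq_zero {d : ℕ} {ν : ℝ} {v : ℝ → (Fin d → ℤ) → Fin d → ℂ}
    {a : ℝ → (Fin d → ℤ) → ℂ}
    (ha : ∀ t ∈ Set.Ici (0 : ℝ),
      HasDerivWithinAt (fun s => a s 0) (fourierRHS ν (v t) (a t) 0) (Set.Ici 0) t)
    (h0 : a 0 0 = 0) {t : ℝ} (ht : 0 ≤ t) : a t 0 = 0 := by
  have hrhs : ∀ t, fourierRHS ν (v t) (a t) 0 = 0 := by
    intro t
    simp [fourierRHS, zdot, znorm]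
  rw [← h0]
  refine (convex_Ici (0 : ℝ)).is_const_of_fderivWithin_eq_zero (𝕜 := ℝ)
    (f := fun s => a s 0) (fun s hs => (ha s hs).differentiableWithinAt) (fun s hs => ?_)
    ht Set.self_mem_Ici
  have := (ha s hs).hasFDerivWithinAt.fderivWithin (uniqueDiffOn_Ici (0 : ℝ) s hs)
  rw [this, hrhs]
  ext
  simp

lemma massOn_Iio_le_mul_negSobolev {d : ℕ} {a : (Fin d → ℤ) → ℂ} (h0 : a 0 = 0) {r : ℝ} :
    massOn a (Set.Iio r) ≤ ENNReal.ofReal ((2 * π * r) ^ 2) *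
      ∑' k : Fin d → ℤ, if k = 0 then 0 else
        (ENNReal.ofReal ((2 * π * znorm k) ^ 2))⁻¹ * (‖a k‖₊ : ℝ≥0∞) ^ 2 := by
  rw [massOn, ← ENNReal.tsum_mul_left]
  refine ENNReal.tsum_le_tsum fun k => ?_
  by_cases hk : k = 0
  · simp [hk, h0]
  have hz := znorm_pos hk
  by_cases hkr : znorm k < r
  · rw [if_pos (Set.mem_Iio.2 hkr), if_neg hk, ← mul_assoc]
    refine le_mul_of_one_le_left (zero_le) ?_
    rw [← div_eq_mul_inv, ENNReal.le_div_iff_mul_le (Or.inl (by positivity)) (Or.inl (by simp)),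
      one_mul]
    exact ENNReal.ofReal_le_ofReal (by gcongr)
  · rw [if_neg (mt Set.mem_Iio.1 hkr)]
    exact zero_le

/-- Below the Batchelor scale, dissipation is negligible on the logarithmic mixing time. -/
lemma dissipation_le {ν r K γ C : ℝ} (hν : 0 < ν) (hν1 : ν ≤ Real.exp (-1)) (hK : 1 ≤ K)
    (hγ : 0 < γ) (hC : 1 ≤ C)
    (hCγ : 64 * π ^ 2 * ((Real.log (16 * π ^ 2 * K) + 1) / γ) ≤ C) (hr : 1 ≤ r)
    (hrν : r ≤ ν ^ (-(1 / 2) : ℝ) / (C * Real.sqrt (Real.log ν⁻¹))) :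
    8 * π ^ 2 * ν * r ^ 2 * (Real.log (16 * π ^ 2 * K * r ^ 2) / γ) ≤ 1 / 8 := by
  set l := Real.log ν⁻¹ with hl
  have hl1 : 1 ≤ l := by
    rw [hl, Real.log_inv]
    have := Real.log_le_log hν hν1
    rw [Real.log_exp] at this
    linarith
  have hsq : (ν ^ (-(1 / 2) : ℝ)) ^ 2 = ν⁻¹ := by
    rw [← Real.rpow_natCast, ← Real.rpow_mul hν.le]
    norm_num
    exact Real.rpow_neg_one ν
  have hr2 : r ^ 2 ≤ ν⁻¹ / (C ^ 2 * l) := by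
    calc r ^ 2 ≤ (ν ^ (-(1 / 2) : ℝ) / (C * Real.sqrt l)) ^ 2 := by gcongr
      _ = _ := by rw [div_pow, mul_pow, hsq, Real.sq_sqrt (by linarith)]
  have hr3 : ν * r ^ 2 * (C ^ 2 * l) ≤ 1 := by
    rw [le_div_iff₀ (by positivity)] at hr2
    calc ν * r ^ 2 * (C ^ 2 * l) = ν * (r ^ 2 * (C ^ 2 * l)) := by ring
      _ ≤ ν * ν⁻¹ := by gcongr
      _ = 1 := mul_inv_cancel₀ hν.ne'
  have hC2 : C ≤ C ^ 2 := by nlinarith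
  have hrinv : r ^ 2 ≤ ν⁻¹ := hr2.trans
    (div_le_self (by positivity) (one_le_mul_of_one_le_of_one_le (hC.trans hC2) hl1))
  have hlogr : Real.log (r ^ 2) ≤ l := Real.log_le_log (by positivity) hrinv
  set q := Real.log (16 * π ^ 2 * K) with hq
  have hpi := Real.pi_gt_three
  have hq0 : 0 ≤ q := Real.log_nonneg (by nlinarith)
  have hlog : Real.log (16 * π ^ 2 * K * r ^ 2) ≤ (q + 1) * l := by
    rw [Real.log_mul (by positivity) (by positivity)]
    nlinarith
  calc 8 * π ^ 2 * ν * r ^ 2 * (Real.log (16 * π ^ 2 * K * r ^ 2) / γ)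
      ≤ 8 * π ^ 2 * ν * r ^ 2 * ((q + 1) * l / γ) := by gcongr
    _ = 1 / 8 * (ν * r ^ 2 * l * (64 * π ^ 2 * ((q + 1) / γ))) := by ring
    _ ≤ 1 / 8 * (ν * r ^ 2 * l * C ^ 2) := by
        gcongr
        exact hCγ.trans hC2
    _ ≤ 1 / 8 * 1 := by
        gcongr
        linarith
    _ = 1 / 8 := by norm_num

/-- for velocities with compact Fourier support and an a.s. bound, every
annulus `[r-L, r+L]` below the Batchelor scale carries at least `1/(CDr)` mass. -/
theorem compact_support_every_annulus_charged (d : ℕ) (hd : 1 ≤ d)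
    (K γ L N₀ : ℝ) (hK : 1 ≤ K) (hγ : 0 < γ) (hL : 1 ≤ L) :
    ∃ C : ℝ, 2 ≤ C ∧
      ∀ (ν : ℝ), 0 < ν → ν ≤ Real.exp (-1) →
      ∀ (Ω : Type) [MeasurableSpace Ω] (ℙ : Measure Ω) [IsProbabilityMeasure ℙ]
        (v : Ω → ℝ → (Fin d → ℤ) → Fin d → ℂ) (a : Ω → ℝ → (Fin d → ℤ) → ℂ)
        (g : (Fin d → ℤ) → ℂ) (D : ℝ), 1 ≤ D →
      AdvectionSetup ℙ ν K γ v a g →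
      N₀ = sInf {s : ℝ | 1 ≤ s ∧ massOn g (Set.Ici s) ≤ ENNReal.ofReal (1 / 4)} →
      (∃ s : ℝ, 1 ≤ s ∧ massOn g (Set.Ici s) ≤ ENNReal.ofReal (1 / 4)) →
      (∀ᵐ ω ∂ℙ, ∀ t : ℝ, 0 ≤ t → ∀ k : Fin d → ℤ,
        cnorm (v ω t k) ≤ if znorm k ≤ L then D else 0) →
      ∀ r : ℝ, C ≤ r → r ≤ ν ^ (-(1 / 2) : ℝ) / (C * Real.sqrt (Real.log ν⁻¹)) →
        ENNReal.ofReal (1 / (C * D * r)) ≤ asymMass ℙ a (Set.Icc (r - L) (r + L)) := by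
  set B := (finite_znorm_le d L).toFinset with hBdef
  have hB : ∀ k, k ∈ B ↔ znorm k ≤ L := by simp [hBdef]
  have hpi := Real.pi_gt_three
  have hq0 : 0 ≤ Real.log (16 * π ^ 2 * K) := Real.log_nonneg (by nlinarith)
  set Q := 64 * π ^ 2 * ((Real.log (16 * π ^ 2 * K) + 1) / γ) with hQ
  have hQ0 : 0 ≤ Q := by positivity
  have hB0 : 0 ≤ 12 * π * B.card := by positivity
  set C := 2 + |N₀| + Q + 12 * π * B.card with hC
  have hN0 := abs_nonneg N₀
  refine ⟨C, by linarith, ?_⟩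
  intro ν hν hν1 Ω _ ℙ _ v a g D hD hset hN₀ hne hvb r hCr hrν
  obtain ⟨hameas, -, hg0, hg1, hpath, hmix⟩ := hset
  have hr1 : 1 ≤ r := by linarith
  set S := ((finite_znorm_le d r).subset
    (fun k (hk : znorm k < r) => hk.le : {k : Fin d → ℤ | znorm k < r} ⊆ _)).toFinset
  have hS : ∀ k, k ∈ S ↔ znorm k < r := fun k => Set.Finite.mem_toFinset _
  set P := ((finite_znorm_le d (r + L)).subset
    (fun k (hk : znorm k ∈ Set.Icc (r - L) (r + L)) => hk.2 :
      {k : Fin d → ℤ | znorm k ∈ Set.Icc (r - L) (r + L)} ⊆ _)).toFinset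
  have hP : ∀ k, k ∈ P ↔ znorm k ∈ Set.Icc (r - L) (r + L) := fun k => Set.Finite.mem_toFinset _
  set T := Real.log (16 * π ^ 2 * K * r ^ 2) / γ with hT
  have harg : 1 ≤ 16 * π ^ 2 * K * r ^ 2 :=
    one_le_mul_of_one_le_of_one_le (by nlinarith) (one_le_pow₀ hr1)
  have hT0 : 0 ≤ T := div_nonneg (Real.log_nonneg harg) hγ.le
  have hdiss : 8 * π ^ 2 * ν * r ^ 2 * T ≤ 1 / 8 :=
    dissipation_le hν hν1 hK hγ (by linarith) (by linarith) hr1 hrν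
  have hinit : ENNReal.ofReal (3 / 4) ≤ massOn g (Set.Iio r) := by
    obtain ⟨s, ⟨-, hs⟩, hsr⟩ := exists_lt_of_csInf_lt hne
      (show sInf {s : ℝ | 1 ≤ s ∧ massOn g (Set.Ici s) ≤ ENNReal.ofReal (1 / 4)} < r by
        rw [← hN₀]; linarith [le_abs_self N₀])
    have h1 := massOn_Iio_add_massOn_Ici g r
    rw [hg1] at h1
    have h2 := (massOn_mono g (Set.Ici_subset_Ici.2 hsr.le)).trans hs
    have h3 : ENNReal.ofReal (3 / 4) + ENNReal.ofReal (1 / 4)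
        ≤ massOn g (Set.Iio r) + ENNReal.ofReal (1 / 4) := by
      rw [← ENNReal.ofReal_add (by norm_num) (by norm_num)]
      norm_num
      rw [← h1]
      norm_num at h2
      gcongr
    exact (ENNReal.add_le_add_iff_right ENNReal.ofReal_ne_top).1 h3
  have hle1 : massOn g (Set.Iio r) ≤ 1 := by
    rw [← hg1, ← massOn_Iio_add_massOn_Ici g r]
    exact le_self_add
  set c := 4 * π * B.card * r * D with hc
  have hc0 : 0 ≤ c := by positivity
  have hpathwise : ∀ᵐ ω ∂ℙ, ENNReal.ofReal (3 / 4) ≤ massOn (a ω T) (Set.Iio r)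
      + ENNReal.ofReal (1 / 8) + ENNReal.ofReal ((1 + 1 / 8) * c) *
        ∫⁻ t in Set.Ici (0 : ℝ), massOn (a ω t) (Set.Icc (r - L) (r + L)) := by
    filter_upwards [hpath, hvb] with ω h1 h2
    have h3 := massOn_initial_le hν.le (by linarith) (by linarith) hT0 h1.1 h1.2.2.1 h2 hdiss
      hS hP hB
    rw [h1.2.1] at h3
    refine hinit.trans (h3.trans ?_)
    gcongr
    exact mul_le_of_le_one_right (zero_le) hle1
  have hfinal : ∫⁻ ω, massOn (a ω T) (Set.Iio r) ∂ℙ ≤ ENNReal.ofReal (1 / 4) := by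
    calc ∫⁻ ω, massOn (a ω T) (Set.Iio r) ∂ℙ
        ≤ ∫⁻ ω, ENNReal.ofReal ((2 * π * r) ^ 2) * (∑' k : Fin d → ℤ, if k = 0 then 0 else
          (ENNReal.ofReal ((2 * π * znorm k) ^ 2))⁻¹ * (‖a ω T k‖₊ : ℝ≥0∞) ^ 2) ∂ℙ := by
          refine lintegral_mono_ae ?_
          filter_upwards [hpath] with ω h1
          exact massOn_Iio_le_mul_negSobolev
            (coeff_zero_eq_zero (h1.2.2.1 0) (by rw [h1.2.1, hg0]) hT0)
      _ ≤ ENNReal.ofReal ((2 * π * r) ^ 2) * ENNReal.ofReal (K * Real.exp (-γ * T)) := by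
          rw [lintegral_const_mul' _ _ ENNReal.ofReal_ne_top]
          gcongr
          exact hmix T hT0
      _ = ENNReal.ofReal (1 / 4) := by
          rw [← ENNReal.ofReal_mul (by positivity)]
          congr 1
          have : -γ * T = -Real.log (16 * π ^ 2 * K * r ^ 2) := by
            rw [hT]
            field_simp
          rw [this, Real.exp_neg, Real.exp_log (by linarith)]
          field_simp
          norm_num
  have hmeas : Measurable fun ω => massOn (a ω T) (Set.Iio r) := by
    refine Measurable.tsum fun k => ?_
    split_ifs
    · have : Measurable fun ω => a ω T k :=
        (hameas k).comp (measurable_id.prodMk measurable_const)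
      fun_prop
    · fun_prop
  set m := asymMass ℙ a (Set.Icc (r - L) (r + L)) with hm
  have hexp : ENNReal.ofReal (3 / 4) ≤ ENNReal.ofReal (1 / 4) + ENNReal.ofReal (1 / 8)
      + ENNReal.ofReal ((1 + 1 / 8) * c) * m := by
    calc ENNReal.ofReal (3 / 4) = ∫⁻ _, ENNReal.ofReal (3 / 4) ∂ℙ := by simp
      _ ≤ _ := lintegral_mono_ae hpathwise
      _ = (∫⁻ ω, massOn (a ω T) (Set.Iio r) ∂ℙ) + ENNReal.ofReal (1 / 8)
          + ENNReal.ofReal ((1 + 1 / 8) * c) * m := by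
          rw [lintegral_add_left (by fun_prop), lintegral_add_left hmeas,
            lintegral_const_mul' _ _ ENNReal.ofReal_ne_top, lintegral_const, measure_univ,
            mul_one, hm, asymMass]
      _ ≤ _ := by gcongr
  rcases eq_or_ne m ⊤ with hmt | hmt
  · rw [hmt]
    exact le_top
  rw [← ENNReal.ofReal_toReal hmt] at hexp ⊢
  have hm0 : 0 ≤ m.toReal := ENNReal.toReal_nonneg
  rw [← ENNReal.ofReal_mul (by positivity), ← ENNReal.ofReal_add (by norm_num) (by norm_num),
    ← ENNReal.ofReal_add (by norm_num) (by positivity),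
    ENNReal.ofReal_le_ofReal_iff (by positivity)] at hexp
  refine ENNReal.ofReal_le_ofReal ?_
  have hCpos : 0 < C * D * r := by
    have : 0 < C := by linarith
    positivity
  rw [div_le_iff₀ hCpos]
  have h3c : 3 * c ≤ C * D * r := by
    have : 12 * π * B.card * (D * r) ≤ C * (D * r) := by
      gcongr
      linarith
    rw [hc]
    linarith
  have := mul_le_mul_of_nonneg_left h3c hm0
  linarith
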